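/- Suppose N > 2 is an integer, δ, μ > 0 satisfy condition (H₁), N/(N−1) < p ≤ 2 and N/(N−1) < q ≤ 2. If 1/(δ+1) + 1/(μ+1) ≤ (N(m−1) − m)/(N(m−1)), where m = min{p,q}, then for every R > 0 the system (S_R) has no radial solution, regular or singular: there is no pair (u,v) of real functions on (0,R], continuously differentiable on (0,R] and twice continuously differentiable on (0,R), with u(r) > 0 and v(r) > 0 for all r ∈ (0,R), u(R) = v(R) = 0, satisfying for all r ∈ (0,R): (r^{N−1}|u'(r)|^{p−2}u'(r))' = −r^{N−1} v(r)^δ and (r^{N−1}|v'(r)|^{q−2}v'(r))' = −r^{N−1} u(r)^μ. -/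

import Mathlib

/-- A radial solution (regular or singular) of system (S_R): only regularity on `(0,R]` is
required and positivity on `(0,R)`. -/
def IsRadialSolutionAux (N : ℕ) (p q δ μ R : ℝ) (u v : ℝ → ℝ) : Prop :=
  ContDiffOn ℝ 1 u (Set.Ioc 0 R) ∧ ContDiffOn ℝ 1 v (Set.Ioc 0 R) ∧
  ContDiffOn ℝ 2 u (Set.Ioo 0 R) ∧ ContDiffOn ℝ 2 v (Set.Ioo 0 R) ∧
  (∀ r ∈ Set.Ioo (0:ℝ) R, 0 < u r) ∧ (∀ r ∈ Set.Ioo (0:ℝ) R, 0 < v r) ∧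
  u R = 0 ∧ v R = 0 ∧
  (∀ r ∈ Set.Ioo (0:ℝ) R,
    deriv (fun s => s ^ ((N:ℝ) - 1) * |deriv u s| ^ (p - 2) * deriv u s) r
      = -(r ^ ((N:ℝ) - 1) * v r ^ δ)) ∧
  (∀ r ∈ Set.Ioo (0:ℝ) R,
    deriv (fun s => s ^ ((N:ℝ) - 1) * |deriv v s| ^ (q - 2) * deriv v s) r
      = -(r ^ ((N:ℝ) - 1) * u r ^ μ))

/-- `h` has logarithmic derivative `k` with respect to `log r` at `r`, that is `r h'(r) = k h(r)`. -/
def HasEulerDerivAt (h : ℝ → ℝ) (k r : ℝ) : Prop := HasDerivAt h (h r * k / r) r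

namespace HasEulerDerivAt

variable {h h₁ h₂ : ℝ → ℝ} {k k₁ k₂ r : ℝ}

lemma mul (H₁ : HasEulerDerivAt h₁ k₁ r) (H₂ : HasEulerDerivAt h₂ k₂ r) :
    HasEulerDerivAt (fun s => h₁ s * h₂ s) (k₁ + k₂) r := by
  unfold HasEulerDerivAt at *
  refine (HasDerivAt.fun_mul H₁ H₂).congr_deriv ?_
  ring

lemma div (H₁ : HasEulerDerivAt h₁ k₁ r) (H₂ : HasEulerDerivAt h₂ k₂ r) (h0 : h₂ r ≠ 0) :
    HasEulerDerivAt (fun s => h₁ s / h₂ s) (k₁ - k₂) r := by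
  unfold HasEulerDerivAt at *
  refine (HasDerivAt.fun_div H₁ H₂ h0).congr_deriv ?_
  field_simp

lemma rpow (H : HasEulerDerivAt h k r) (h0 : 0 < h r) (a : ℝ) :
    HasEulerDerivAt (fun s => h s ^ a) (a * k) r := by
  unfold HasEulerDerivAt at *
  convert H.rpow_const (p := a) (Or.inl h0.ne') using 1
  rw [Real.rpow_sub_one h0.ne']
  field_simp

lemma congr (H : HasEulerDerivAt h₁ k r) (e : h₂ =ᶠ[nhds r] h₁) : HasEulerDerivAt h₂ k r := by
  unfold HasEulerDerivAt at *
  rw [e.self_of_nhds]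
  exact H.congr_of_eventuallyEq e

end HasEulerDerivAt

lemma hasEulerDerivAt_id {r : ℝ} (hr : 0 < r) : HasEulerDerivAt (fun s => s) 1 r := by
  unfold HasEulerDerivAt
  refine (hasDerivAt_id r).congr_deriv ?_
  field_simp

lemma hasEulerDerivAt_rpow {r : ℝ} (hr : 0 < r) (a : ℝ) :
    HasEulerDerivAt (fun s => s ^ a) a r := by
  simpa using (hasEulerDerivAt_id hr).rpow hr a

/-- A positive function on `(0, ρ)` cannot grow at least logarithmically. -/
lemma not_log_growth {h h' : ℝ → ℝ} {ρ c : ℝ} (hρ : 0 < ρ) (hc : 0 < c)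
    (hpos : ∀ r ∈ Set.Ioo 0 ρ, 0 < h r)
    (hd : ∀ r ∈ Set.Ioo 0 ρ, HasDerivAt h (h' r) r)
    (hg : ∀ r ∈ Set.Ioo 0 ρ, c ≤ r * h' r) : False := by
  have hmono : MonotoneOn (fun r => h r - c * Real.log r) (Set.Ioo 0 ρ) := by
    have hd' : ∀ r ∈ Set.Ioo 0 ρ,
        HasDerivAt (fun r => h r - c * Real.log r) (h' r - c * r⁻¹) r := fun r hr =>
      (hd r hr).sub ((Real.hasDerivAt_log hr.1.ne').const_mul c)
    refine monotoneOn_of_deriv_nonneg (convex_Ioo _ _)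
      (fun r hr => (hd' r hr).continuousAt.continuousWithinAt) ?_ ?_
    · rw [interior_Ioo]
      exact fun r hr => (hd' r hr).differentiableAt.differentiableWithinAt
    · rw [interior_Ioo]
      intro r hr
      rw [(hd' r hr).deriv, sub_nonneg, ← div_eq_mul_inv, div_le_iff₀ hr.1, mul_comm]
      exact hg r hr
  have hm : ρ / 2 ∈ Set.Ioo 0 ρ := ⟨by linarith, by linarith⟩
  have hlog : Filter.Tendsto (fun r => h (ρ / 2) - c * Real.log (ρ / 2) + c * Real.log r)
      (nhdsWithin 0 (Set.Ioi 0)) Filter.atBot :=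
    Filter.tendsto_atBot_add_const_left _ _
      (Real.tendsto_log_nhdsGT_zero.const_mul_atBot hc)
  have hev : ∀ᶠ r in nhdsWithin (0:ℝ) (Set.Ioi 0), r ∈ Set.Ioo 0 (ρ / 2) :=
    Ioo_mem_nhdsGT hm.1
  obtain ⟨r, hr1, hr2⟩ := ((hlog.eventually_lt_atBot 0).and hev).exists
  have hr3 : r ∈ Set.Ioo 0 ρ := ⟨hr2.1, by linarith [hr2.2]⟩
  have := hmono hr3 hm hr2.2.le
  have := hpos r hr3
  simp only at *
  linarith

/-- The weighted flux `r^(n-1) f^(p-1)`. -/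
noncomputable def radialFlux (n p : ℝ) (f : ℝ → ℝ) (r : ℝ) : ℝ := r ^ (n - 1) * f r ^ (p - 1)

/-- One equation of the radial system, for a decreasing `u` with slope `-f` and source `v ^ δ`. -/
structure RadialHalf (n p δ R : ℝ) (u f v : ℝ → ℝ) : Prop where
  pos : ∀ r ∈ Set.Ioo 0 R, 0 < u r
  slope_pos : ∀ r ∈ Set.Ioo 0 R, 0 < f r
  hasDerivAt : ∀ r ∈ Set.Ioo 0 R, HasDerivAt u (-f r) r
  flux : ∀ r ∈ Set.Ioo 0 R, HasDerivAt (radialFlux n p f) (r ^ (n - 1) * v r ^ δ) r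

/-- The scale-invariant slope `r f / u`. -/
noncomputable def slopeRatio (u f : ℝ → ℝ) (r : ℝ) : ℝ := r * f r / u r

/-- The scale-invariant source `r v^δ / f^(p-1)`. -/
noncomputable def sourceRatio (n p δ : ℝ) (f v : ℝ → ℝ) (r : ℝ) : ℝ :=
  r ^ n * v r ^ δ / radialFlux n p f r

namespace RadialHalf

variable {n p q δ μ R r : ℝ} {u v f g : ℝ → ℝ}

lemma flux_pos (H : RadialHalf n p δ R u f v) (hr : r ∈ Set.Ioo 0 R) :
    0 < radialFlux n p f r :=
  mul_pos (Real.rpow_pos_of_pos hr.1 _) (Real.rpow_pos_of_pos (H.slope_pos r hr) _)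

lemma slopeRatio_pos (H : RadialHalf n p δ R u f v) (hr : r ∈ Set.Ioo 0 R) :
    0 < slopeRatio u f r :=
  div_pos (mul_pos hr.1 (H.slope_pos r hr)) (H.pos r hr)

lemma sourceRatio_pos (H : RadialHalf n p δ R u f v) (H' : RadialHalf n q μ R v g u)
    (hr : r ∈ Set.Ioo 0 R) : 0 < sourceRatio n p δ f v r :=
  div_pos (mul_pos (Real.rpow_pos_of_pos hr.1 _) (Real.rpow_pos_of_pos (H'.pos r hr) _))
    (H.flux_pos hr)

lemma euler_flux (H : RadialHalf n p δ R u f v) (hr : r ∈ Set.Ioo 0 R) :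
    HasEulerDerivAt (radialFlux n p f) (sourceRatio n p δ f v r) r := by
  unfold HasEulerDerivAt
  convert H.flux r hr using 1
  have h1 := H.flux_pos hr
  have h2 := hr.1
  rw [sourceRatio, Real.rpow_sub_one h2.ne']
  field_simp

lemma euler_solution (H : RadialHalf n p δ R u f v) (hr : r ∈ Set.Ioo 0 R) :
    HasEulerDerivAt u (-slopeRatio u f r) r := by
  unfold HasEulerDerivAt
  convert H.hasDerivAt r hr using 1
  have h1 := H.pos r hr
  have h2 := hr.1
  rw [slopeRatio]
  field_simp

lemma slope_eq (H : RadialHalf n p δ R u f v) (hp : 1 < p) (hr : r ∈ Set.Ioo 0 R) :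
    f r = (radialFlux n p f r * r ^ (1 - n)) ^ (1 / (p - 1)) := by
  have h1 := H.slope_pos r hr
  have h2 := hr.1
  have e : radialFlux n p f r * r ^ (1 - n) = f r ^ (p - 1) := by
    have : r ^ (n - 1) * r ^ (1 - n) = 1 := by
      rw [← Real.rpow_add h2]; simp
    rw [radialFlux]
    linear_combination f r ^ (p - 1) * this
  have : (p - 1) * (1 / (p - 1)) = 1 := by
    have : p - 1 ≠ 0 := by linarith
    field_simp
  rw [e, ← Real.rpow_mul h1.le, this, Real.rpow_one]

lemma euler_slope (H : RadialHalf n p δ R u f v) (hp : 1 < p) (hr : r ∈ Set.Ioo 0 R) :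
    HasEulerDerivAt f ((sourceRatio n p δ f v r - (n - 1)) / (p - 1)) r := by
  have h1 := ((H.euler_flux hr).mul (hasEulerDerivAt_rpow hr.1 (1 - n))).rpow
    (mul_pos (H.flux_pos hr) (Real.rpow_pos_of_pos hr.1 _)) (1 / (p - 1))
  have e : f =ᶠ[nhds r] fun s => (radialFlux n p f s * s ^ (1 - n)) ^ (1 / (p - 1)) := by
    filter_upwards [Ioo_mem_nhds hr.1 hr.2] with s hs
    exact H.slope_eq hp hs
  convert h1.congr e using 1
  ring

lemma euler_slopeRatio (H : RadialHalf n p δ R u f v) (hp : 1 < p) (hr : r ∈ Set.Ioo 0 R) :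
    HasEulerDerivAt (slopeRatio u f)
      (1 + (sourceRatio n p δ f v r - (n - 1)) / (p - 1) + slopeRatio u f r) r := by
  have := ((hasEulerDerivAt_id hr.1).mul (H.euler_slope hp hr)).div (H.euler_solution hr)
    (H.pos r hr).ne'
  rw [sub_neg_eq_add] at this
  exact this

lemma euler_sourceRatio (H : RadialHalf n p δ R u f v) (H' : RadialHalf n q μ R v g u)
    (hr : r ∈ Set.Ioo 0 R) :
    HasEulerDerivAt (sourceRatio n p δ f v)
      (n - δ * slopeRatio v g r - sourceRatio n p δ f v r) r := by
  have := ((hasEulerDerivAt_rpow hr.1 n).mul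
    ((H'.euler_solution hr).rpow (H'.pos r hr) δ)).div (H.euler_flux hr) (H.flux_pos hr).ne'
  rw [mul_neg, ← sub_eq_add_neg] at this
  exact this

lemma antitoneOn (H : RadialHalf n p δ R u f v) : AntitoneOn u (Set.Ioo 0 R) := by
  refine antitoneOn_of_deriv_nonpos (convex_Ioo _ _)
    (fun r hr => (H.hasDerivAt r hr).continuousAt.continuousWithinAt) ?_ ?_
  · rw [interior_Ioo]
    exact fun r hr => (H.hasDerivAt r hr).differentiableAt.differentiableWithinAt
  · rw [interior_Ioo]
    intro r hr
    rw [(H.hasDerivAt r hr).deriv]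
    linarith [H.slope_pos r hr]

lemma flux_monotoneOn (H : RadialHalf n p δ R u f v) (H' : RadialHalf n q μ R v g u) :
    MonotoneOn (radialFlux n p f) (Set.Ioo 0 R) := by
  refine monotoneOn_of_deriv_nonneg (convex_Ioo _ _)
    (fun r hr => (H.flux r hr).continuousAt.continuousWithinAt) ?_ ?_
  · rw [interior_Ioo]
    exact fun r hr => (H.flux r hr).differentiableAt.differentiableWithinAt
  · rw [interior_Ioo]
    intro r hr
    rw [(H.flux r hr).deriv]
    exact (mul_pos (Real.rpow_pos_of_pos hr.1 _) (Real.rpow_pos_of_pos (H'.pos r hr) _)).le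

lemma sourceRatio_le (H : RadialHalf n p δ R u f v) (H' : RadialHalf n q μ R v g u)
    (hn : 0 < n) (hδ : 0 < δ) (hr : r ∈ Set.Ioo 0 R) : sourceRatio n p δ f v r ≤ n := by
  set a := v r ^ δ with ha
  have hsub : ∀ {s}, s ∈ Set.Ioc 0 r → s ∈ Set.Ioo 0 R := fun hs => ⟨hs.1, hs.2.trans_lt hr.2⟩
  have hd : ∀ s ∈ Set.Ioc 0 r, HasDerivAt (fun s => radialFlux n p f s - s ^ n * (a / n))
      (s ^ (n - 1) * v s ^ δ - n * s ^ (n - 1) * (a / n)) s := fun s hs =>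
    (H.flux s (hsub hs)).sub
      ((Real.hasDerivAt_rpow_const (Or.inl hs.1.ne')).mul_const _)
  have hmono : MonotoneOn (fun s => radialFlux n p f s - s ^ n * (a / n)) (Set.Ioc 0 r) := by
    refine monotoneOn_of_deriv_nonneg (convex_Ioc _ _)
      (fun s hs => (hd s hs).continuousAt.continuousWithinAt) ?_ ?_
    · exact fun s hs =>
        (hd s (interior_subset hs)).differentiableAt.differentiableWithinAt
    · intro s hs
      have hs := interior_subset hs
      rw [(hd s hs).deriv]
      have h1 : a ≤ v s ^ δ :=
        Real.rpow_le_rpow (H'.pos r hr).le (H'.antitoneOn (hsub hs) hr hs.2) hδ.le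
      have h2 : 0 < s ^ (n - 1) := Real.rpow_pos_of_pos hs.1 _
      have h3 : n * s ^ (n - 1) * (a / n) = s ^ (n - 1) * a := by field_simp
      rw [h3]
      nlinarith
  have hlim : Filter.Tendsto (fun s : ℝ => -(s ^ n * (a / n))) (nhdsWithin 0 (Set.Ioi 0))
      (nhds 0) := by
    have : ContinuousAt (fun s : ℝ => -(s ^ n * (a / n))) 0 :=
      ((Real.continuousAt_rpow_const 0 n (Or.inr hn.le)).mul continuousAt_const).neg
    have h := this.tendsto
    simp only [Real.zero_rpow hn.ne', zero_mul, neg_zero] at h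
    exact h.mono_left nhdsWithin_le_nhds
  have hge : 0 ≤ radialFlux n p f r - r ^ n * (a / n) := by
    refine le_of_tendsto hlim ?_
    filter_upwards [Ioo_mem_nhdsGT hr.1] with s hs
    have h1 := hmono ⟨hs.1, hs.2.le⟩ ⟨hr.1, le_rfl⟩ hs.2.le
    have h2 := H.flux_pos (hsub ⟨hs.1, hs.2.le⟩)
    simp only at h1
    linarith
  rw [sourceRatio, div_le_iff₀ (H.flux_pos hr)]
  have : r ^ n * (a / n) = r ^ n * a / n := by ring
  rw [this, sub_nonneg, div_le_iff₀ hn] at hge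
  linarith

lemma slopeRatio_le (H : RadialHalf n p δ R u f v) (H' : RadialHalf n q μ R v g u)
    (hn : 1 < n) (hp : 1 < p) (hr : r ∈ Set.Ioo 0 (R / 2)) :
    slopeRatio u f r ≤ 2 ^ ((n - 1) / (p - 1)) := by
  have hr0 := hr.1
  have hr1 : r ∈ Set.Ioo 0 R := ⟨hr.1, by linarith [hr.1, hr.2]⟩
  have hr2 : 2 * r ∈ Set.Ioo 0 R := ⟨by linarith, by linarith [hr.2]⟩
  have hsub : ∀ {s}, s ∈ Set.Icc r (2 * r) → s ∈ Set.Ioo 0 R := fun hs =>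
    ⟨hr.1.trans_le hs.1, hs.2.trans_lt hr2.2⟩
  obtain ⟨c, hc, hc'⟩ := exists_hasDerivAt_eq_slope u (fun s => -f s) (by linarith : r < 2 * r)
    (fun s hs => (H.hasDerivAt s (hsub hs)).continuousAt.continuousWithinAt)
    (fun s hs => H.hasDerivAt s (hsub ⟨hs.1.le, hs.2.le⟩))
  have hcm := hsub ⟨hc.1.le, hc.2.le⟩
  have hfc := H.slope_pos c hcm
  have hfr := H.slope_pos r hr1
  have hle : f r ≤ 2 ^ ((n - 1) / (p - 1)) * f c := by
    have h1 := H.flux_monotoneOn H' hr1 hcm hc.1.le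
    have h2 : c ^ (n - 1) ≤ 2 ^ (n - 1) * r ^ (n - 1) := by
      rw [← Real.mul_rpow (by norm_num) hr0.le]
      exact Real.rpow_le_rpow hcm.1.le hc.2.le (by linarith)
    have h3 : f r ^ (p - 1) ≤ 2 ^ (n - 1) * f c ^ (p - 1) := by
      have h4 : 0 < r ^ (n - 1) := Real.rpow_pos_of_pos hr0 _
      have h5 : 0 < f c ^ (p - 1) := Real.rpow_pos_of_pos hfc _
      unfold radialFlux at h1
      have : r ^ (n - 1) * f r ^ (p - 1) ≤ r ^ (n - 1) * (2 ^ (n - 1) * f c ^ (p - 1)) := by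
        nlinarith
      exact le_of_mul_le_mul_left this h4
    have hp0 : 0 < p - 1 := by linarith
    rw [← Real.rpow_le_rpow_iff hfr.le (by positivity) hp0, Real.mul_rpow (by positivity) hfc.le,
      ← Real.rpow_mul (by norm_num), div_mul_cancel₀ _ hp0.ne']
    exact h3
  have h6 : u r - u (2 * r) = r * f c := by
    rw [eq_div_iff (by linarith)] at hc'
    linarith
  have h7 := H.pos _ hr2
  rw [slopeRatio, div_le_iff₀ (H.pos r hr1)]
  have h8 : (0:ℝ) < 2 ^ ((n - 1) / (p - 1)) := by positivity
  calc r * f r ≤ r * (2 ^ ((n - 1) / (p - 1)) * f c) := by gcongr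
    _ = 2 ^ ((n - 1) / (p - 1)) * (r * f c) := by ring
    _ ≤ _ := by gcongr; linarith

end RadialHalf

/-- The scale-invariant quotient `(n - Z) / ((δ + 1) Y)`, with `Z` the source ratio of the first
equation and `Y` the slope ratio of the second one. -/
noncomputable def deficitRatio (n p δ : ℝ) (f v g : ℝ → ℝ) (r : ℝ) : ℝ :=
  (n - sourceRatio n p δ f v r) / ((δ + 1) * slopeRatio v g r)

/-- The scale-invariant part of the energy. -/
noncomputable def energyDensity (n p q δ μ : ℝ) (u v f g : ℝ → ℝ) (r : ℝ) : ℝ :=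
  1 - deficitRatio n p δ f v g r - deficitRatio n q μ g u f r

/-- The energy `r^(-K) P Q Φ` with `P`, `Q` the two fluxes and `Φ` the energy density. -/
noncomputable def radialEnergy (n p q δ μ K : ℝ) (u v f g : ℝ → ℝ) (r : ℝ) : ℝ :=
  r ^ (-K) * radialFlux n p f r * radialFlux n q g r * energyDensity n p q δ μ u v f g r

namespace RadialHalf

variable {n p q δ μ K R r : ℝ} {u v f g : ℝ → ℝ}

lemma deficitRatio_nonneg (H : RadialHalf n p δ R u f v) (H' : RadialHalf n q μ R v g u)
    (hn : 0 < n) (hδ : 0 < δ) (hr : r ∈ Set.Ioo 0 R) : 0 ≤ deficitRatio n p δ f v g r :=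
  div_nonneg (sub_nonneg.2 (H.sourceRatio_le H' hn hδ hr))
    (mul_pos (by linarith) (H'.slopeRatio_pos hr)).le

lemma hasDerivAt_deficitRatio (H : RadialHalf n p δ R u f v) (H' : RadialHalf n q μ R v g u)
    (hq : 1 < q) (hδ : 0 < δ) (hr : r ∈ Set.Ioo 0 R) :
    HasDerivAt (deficitRatio n p δ f v g)
      ((sourceRatio n p δ f v r - n / (δ + 1) + deficitRatio n p δ f v g r *
        ((n - 1 - sourceRatio n q μ g u r) / (q - 1) - 1 - sourceRatio n p δ f v r)) / r) r := by
  have hY := H'.slopeRatio_pos hr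
  have hr0 := hr.1
  have hq0 : q - 1 ≠ 0 := by linarith
  have hδ0 : δ + 1 ≠ 0 := by linarith
  have h1 : HasDerivAt _ _ r := H.euler_sourceRatio H' hr
  have h2 : HasDerivAt _ _ r := H'.euler_slopeRatio hq hr
  refine ((h1.const_sub n).fun_div (h2.const_mul (δ + 1)) (by positivity)).congr_deriv ?_
  unfold deficitRatio
  generalize slopeRatio v g r = Y at *
  generalize sourceRatio n p δ f v r = Z at *
  generalize sourceRatio n q μ g u r = W at *
  field_simp
  ring

lemma hasDerivAt_radialEnergy (H : RadialHalf n p δ R u f v) (H' : RadialHalf n q μ R v g u)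
    (hp : 1 < p) (hq : 1 < q) (hδ : 0 < δ) (hμ : 0 < μ) (hr : r ∈ Set.Ioo 0 R) :
    HasDerivAt (radialEnergy n p q δ μ K u v f g)
      (r ^ (-K) * radialFlux n p f r * radialFlux n q g r / r *
        (energyDensity n p q δ μ u v f g r *
            (sourceRatio n p δ f v r + sourceRatio n q μ g u r - K)
          - (sourceRatio n p δ f v r - n / (δ + 1) + deficitRatio n p δ f v g r *
        ((n - 1 - sourceRatio n q μ g u r) / (q - 1) - 1 - sourceRatio n p δ f v r))
          - (sourceRatio n q μ g u r - n / (μ + 1) + deficitRatio n q μ g u f r *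
        ((n - 1 - sourceRatio n p δ f v r) / (p - 1) - 1 - sourceRatio n q μ g u r)))) r := by
  have h1 : HasDerivAt _ _ r :=
    ((hasEulerDerivAt_rpow hr.1 (-K)).mul (H.euler_flux hr)).mul (H'.euler_flux hr)
  have h2 := ((H.hasDerivAt_deficitRatio H' hq hδ hr).const_sub 1).fun_sub
    (H'.hasDerivAt_deficitRatio H hp hμ hr)
  refine (h1.fun_mul h2).congr_deriv ?_
  have hr0 := hr.1
  unfold energyDensity
  field_simp
  ring

lemma radialEnergy_antitoneOn (H : RadialHalf n p δ R u f v) (H' : RadialHalf n q μ R v g u)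
    (hn : 0 < n) (hp : 1 < p) (hq : 1 < q) (hp2 : p ≤ 2) (hq2 : q ≤ 2)
    (hδ : 0 < δ) (hμ : 0 < μ)
    (hpK : p / (p - 1) ≤ n - K) (hqK : q / (q - 1) ≤ n - K)
    (hK : n / (δ + 1) + n / (μ + 1) ≤ K) :
    AntitoneOn (radialEnergy n p q δ μ K u v f g) (Set.Ioo 0 R) := by
  refine antitoneOn_of_deriv_nonpos (convex_Ioo _ _)
    (fun r hr => (H.hasDerivAt_radialEnergy H' hp hq hδ hμ hr).continuousAt.continuousWithinAt)
    ?_ ?_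
  · rw [interior_Ioo]
    exact fun r hr =>
      (H.hasDerivAt_radialEnergy H' hp hq hδ hμ hr).differentiableAt.differentiableWithinAt
  · rw [interior_Ioo]
    intro r hr
    rw [(H.hasDerivAt_radialEnergy H' hp hq hδ hμ hr).deriv]
    have hA := H.deficitRatio_nonneg H' hn hδ hr
    have hB := H'.deficitRatio_nonneg H hn hμ hr
    have hZ := H.sourceRatio_le H' hn hδ hr
    have hW := H'.sourceRatio_le H hn hμ hr
    have hP := H.flux_pos hr
    have hQ := H'.flux_pos hr
    have hrK := Real.rpow_pos_of_pos hr.1 (-K)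
    have hr0 := hr.1
    refine mul_nonpos_of_nonneg_of_nonpos (by positivity) ?_
    unfold energyDensity
    generalize sourceRatio n p δ f v r = Z at *
    generalize sourceRatio n q μ g u r = W at *
    generalize deficitRatio n p δ f v g r = A at *
    generalize deficitRatio n q μ g u f r = B at *
    have key : ∀ {s T : ℝ}, 1 < s → s ≤ 2 → T ≤ n → s / (s - 1) ≤ n - K →
        K - T ≤ (n - 1 - T) / (s - 1) - 1 := by
      intro s T h1 h2 h3 h4
      have h5 : 0 < s - 1 := by linarith
      have h6 : (n - 1 - T) / (s - 1) - 1 = (n - T) / (s - 1) - s / (s - 1) := by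
        field_simp
        ring
      have h7 : n - T ≤ (n - T) / (s - 1) := by
        rw [le_div_iff₀ h5]
        nlinarith
      linarith
    have k1 := mul_le_mul_of_nonneg_left (key hq hq2 hW hqK) hA
    have k2 := mul_le_mul_of_nonneg_left (key hp hp2 hZ hpK) hB
    nlinarith

lemma eventually_deficitRatio_lt (H : RadialHalf n p δ R u f v) (H' : RadialHalf n q μ R v g u)
    (hR : 0 < R) (hn : 1 < n) (hq : 1 < q) (hδ : 0 < δ)
    (hv : Filter.Tendsto v (nhdsWithin R (Set.Iio R)) (nhds 0)) :
    ∀ᶠ r in nhdsWithin R (Set.Iio R), deficitRatio n p δ f v g r < 1 / 2 := by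
  have hm : R / 2 ∈ Set.Ioo 0 R := ⟨by linarith, by linarith⟩
  have hQ := H'.flux_pos hm
  set c := (radialFlux n q g (R / 2) * R ^ (1 - n)) ^ (1 / (q - 1)) with hc
  have hc0 : 0 < c := Real.rpow_pos_of_pos (mul_pos hQ (Real.rpow_pos_of_pos hR _)) _
  have hε : 0 < R / 2 * c / (2 * n) := by positivity
  filter_upwards [Ioo_mem_nhdsLT hm.2, hv.eventually_lt_const hε] with r hr hvr
  have hr' : r ∈ Set.Ioo 0 R := ⟨hm.1.trans hr.1, hr.2⟩
  have hg : c ≤ g r := by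
    rw [H'.slope_eq hq hr', hc]
    have h1 := H'.flux_monotoneOn H hm hr' hr.1.le
    have h2 : R ^ (1 - n) ≤ r ^ (1 - n) :=
      Real.rpow_le_rpow_of_nonpos hr'.1 hr.2.le (by linarith)
    have h3 : 0 < R ^ (1 - n) := Real.rpow_pos_of_pos hR _
    have h4 : 0 ≤ 1 / (q - 1) := by
      have : 0 < q - 1 := by linarith
      positivity
    have h5 := H'.flux_pos hr'
    gcongr
  have hY := H'.slopeRatio_pos hr'
  have hZ := H.sourceRatio_pos H' hr'
  have hvp := H'.pos r hr'
  have hYn : 2 * n < slopeRatio v g r := by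
    rw [slopeRatio, lt_div_iff₀ hvp]
    rw [lt_div_iff₀ (by positivity)] at hvr
    have : R / 2 * c ≤ r * g r := mul_le_mul hr.1.le hg hc0.le hr'.1.le
    linarith
  rw [deficitRatio, div_lt_iff₀ (by positivity)]
  nlinarith

lemma exists_radialEnergy_lower_bound (H : RadialHalf n p δ R u f v)
    (H' : RadialHalf n q μ R v g u) (hR : 0 < R)
    (hn : 1 < n) (hp : 1 < p) (hq : 1 < q) (hp2 : p ≤ 2) (hq2 : q ≤ 2)
    (hδ : 0 < δ) (hμ : 0 < μ)
    (hpK : p / (p - 1) ≤ n - K) (hqK : q / (q - 1) ≤ n - K)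
    (hK : n / (δ + 1) + n / (μ + 1) ≤ K)
    (hu : Filter.Tendsto u (nhdsWithin R (Set.Iio R)) (nhds 0))
    (hv : Filter.Tendsto v (nhdsWithin R (Set.Iio R)) (nhds 0)) :
    ∃ c > 0, ∀ r ∈ Set.Ioo 0 (R / 2), c ≤ radialEnergy n p q δ μ K u v f g r := by
  obtain ⟨r₁, ⟨hA, hB⟩, hr₁⟩ := (((H.eventually_deficitRatio_lt H' hR hn hq hδ hv).and
    (H'.eventually_deficitRatio_lt H hR hn hp hμ hu)).and
    (Ioo_mem_nhdsLT (by linarith : R / 2 < R))).exists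
  have hr : r₁ ∈ Set.Ioo 0 R := ⟨by linarith [hr₁.1], hr₁.2⟩
  refine ⟨radialEnergy n p q δ μ K u v f g r₁, ?_, fun r hr' => ?_⟩
  · have h1 := H.flux_pos hr
    have h2 := H'.flux_pos hr
    have h3 := Real.rpow_pos_of_pos hr.1 (-K)
    have h4 : 0 < energyDensity n p q δ μ u v f g r₁ := by
      unfold energyDensity
      linarith
    unfold radialEnergy
    positivity
  · exact H.radialEnergy_antitoneOn H' (by linarith) hp hq hp2 hq2 hδ hμ hpK hqK hK
      ⟨hr'.1, by linarith [hr'.2]⟩ hr (by linarith [hr'.2, hr₁.1])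

end RadialHalf

namespace RadialHalf

variable {n p q δ μ K R r c : ℝ} {u v f g : ℝ → ℝ}

lemma exists_log_flux_le (H : RadialHalf n p δ R u f v) (H' : RadialHalf n q μ R v g u)
    (hn : 1 < n) (hp : 1 < p) :
    ∃ C, ∀ r ∈ Set.Ioo 0 (R / 2), Real.log (radialFlux n p f r) ≤
      C + (n - p) * Real.log r + (p - 1) * Real.log (u r) := by
  refine ⟨(p - 1) * Real.log (2 ^ ((n - 1) / (p - 1))), fun r hr => ?_⟩
  have hr' : r ∈ Set.Ioo 0 R := ⟨hr.1, by linarith [hr.1, hr.2]⟩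
  have hf := H.slope_pos r hr'
  have hu := H.pos r hr'
  have h1 := Real.log_le_log (H.slopeRatio_pos hr') (H.slopeRatio_le H' hn hp hr)
  rw [slopeRatio, Real.log_div (mul_pos hr.1 hf).ne' hu.ne', Real.log_mul hr.1.ne' hf.ne'] at h1
  rw [radialFlux, Real.log_mul (Real.rpow_pos_of_pos hr.1 _).ne' (Real.rpow_pos_of_pos hf _).ne',
    Real.log_rpow hr.1, Real.log_rpow hf]
  nlinarith

lemma exists_log_source_le (H : RadialHalf n p δ R u f v) (H' : RadialHalf n q μ R v g u)
    (hn : 1 < n) (hp : 1 < p) (hδ : 0 < δ) :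
    ∃ C, ∀ r ∈ Set.Ioo 0 (R / 2), δ * Real.log (v r) ≤
      C + (p - 1) * Real.log (u r) - p * Real.log r := by
  obtain ⟨C, hC⟩ := H.exists_log_flux_le H' hn hp
  refine ⟨C + Real.log n, fun r hr => ?_⟩
  have hr' : r ∈ Set.Ioo 0 R := ⟨hr.1, by linarith [hr.1, hr.2]⟩
  have hv := H'.pos r hr'
  have h1 := Real.log_le_log (H.sourceRatio_pos H' hr') (H.sourceRatio_le H' (by linarith) hδ hr')
  have hrn := Real.rpow_pos_of_pos hr.1 n
  have hvd := Real.rpow_pos_of_pos hv δ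
  rw [sourceRatio, Real.log_div (mul_pos hrn hvd).ne' (H.flux_pos hr').ne',
    Real.log_mul hrn.ne' hvd.ne', Real.log_rpow hr.1, Real.log_rpow hv] at h1
  linarith [hC r hr]

/-- Upper bound for the singular behaviour at the origin. -/
lemma exists_log_solution_le (H : RadialHalf n p δ R u f v) (H' : RadialHalf n q μ R v g u)
    (hn : 1 < n) (hp : 1 < p) (hq : 1 < q) (hδ : 0 < δ) (hμ : 0 < μ) :
    ∃ C, ∀ r ∈ Set.Ioo 0 (R / 2), (δ * μ - (p - 1) * (q - 1)) * Real.log (u r) ≤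
      C - (p * (q - 1) + q * δ) * Real.log r := by
  obtain ⟨C₁, h₁⟩ := H.exists_log_source_le H' hn hp hδ
  obtain ⟨C₂, h₂⟩ := H'.exists_log_source_le H hn hq hμ
  refine ⟨(q - 1) * C₁ + δ * C₂, fun r hr => ?_⟩
  have e₁ := mul_le_mul_of_nonneg_left (h₁ r hr) (by linarith : 0 ≤ q - 1)
  have e₂ := mul_le_mul_of_nonneg_left (h₂ r hr) hδ.le
  linarith

lemma log_energy_le (H : RadialHalf n p δ R u f v) (H' : RadialHalf n q μ R v g u)
    (hn : 0 < n) (hδ : 0 < δ) (hμ : 0 < μ) (hc : 0 < c) (hr : r ∈ Set.Ioo 0 R)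
    (hE : c ≤ radialEnergy n p q δ μ K u v f g r) :
    Real.log c ≤ -K * Real.log r + Real.log (radialFlux n p f r) +
      Real.log (radialFlux n q g r) := by
  have hP := H.flux_pos hr
  have hQ := H'.flux_pos hr
  have hrK := Real.rpow_pos_of_pos hr.1 (-K)
  have hΦ : energyDensity n p q δ μ u v f g r ≤ 1 := by
    unfold energyDensity
    linarith [H.deficitRatio_nonneg H' hn hδ hr, H'.deficitRatio_nonneg H hn hμ hr]
  rw [← Real.log_rpow hr.1, ← Real.log_mul hrK.ne' hP.ne', ← Real.log_mul (by positivity) hQ.ne']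
  refine Real.log_le_log hc (hE.trans ?_)
  unfold radialEnergy
  exact mul_le_of_le_one_right (by positivity) hΦ

lemma false_of_supercritical (H : RadialHalf n p δ R u f v) (H' : RadialHalf n q μ R v g u)
    (hR : 0 < R) (hn : 1 < n) (hp : 1 < p) (hq : 1 < q) (hδ : 0 < δ) (hμ : 0 < μ)
    (hH : 0 < δ * μ - (p - 1) * (q - 1)) (hc : 0 < c)
    (hE : ∀ r ∈ Set.Ioo 0 (R / 2), c ≤ radialEnergy n p q δ μ K u v f g r)
    (hM : δ * μ * (p + q) + q * (p - 1) * δ + p * (q - 1) * μ <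
      (δ * μ - (p - 1) * (q - 1)) * (2 * n - K)) : False := by
  obtain ⟨C₁, h₁⟩ := H.exists_log_solution_le H' hn hp hq hδ hμ
  obtain ⟨C₂, h₂⟩ := H'.exists_log_solution_le H hn hq hp hμ hδ
  obtain ⟨C₃, h₃⟩ := H.exists_log_flux_le H' hn hp
  obtain ⟨C₄, h₄⟩ := H'.exists_log_flux_le H hn hq
  set D := δ * μ - (p - 1) * (q - 1) with hD
  set M := D * (2 * n - K) - (δ * μ * (p + q) + q * (p - 1) * δ + p * (q - 1) * μ) with hMd
  have hM0 : 0 < M := by linarith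
  have hlim := (Real.tendsto_log_nhdsGT_zero.const_mul_atBot hM0).eventually_lt_atBot
    (D * Real.log c - (D * (C₃ + C₄) + (p - 1) * C₁ + (q - 1) * C₂))
  obtain ⟨r, hr1, hr⟩ :=
    (hlim.and (Ioo_mem_nhdsGT (by linarith : 0 < R / 2))).exists
  have hr' : r ∈ Set.Ioo 0 R := ⟨hr.1, by linarith [hr.1, hr.2]⟩
  have e₀ := H.log_energy_le H' (by linarith) hδ hμ hc hr' (hE r hr)
  have e₁ := mul_le_mul_of_nonneg_left (h₁ r hr) (by linarith : 0 ≤ p - 1)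
  have e₂ := mul_le_mul_of_nonneg_left (h₂ r hr) (by linarith : 0 ≤ q - 1)
  have e₃ := h₃ r hr
  have e₄ := h₄ r hr
  have e₅ := mul_le_mul_of_nonneg_left
    (e₀.trans (add_le_add (add_le_add le_rfl e₃) e₄)) hH.le
  have hD' : μ * δ - (q - 1) * (p - 1) = D := by rw [hD]; ring
  rw [hD'] at e₂
  generalize Real.log r = L at *
  generalize Real.log (u r) = a at *
  generalize Real.log (v r) = b at *
  have hML : M * L = D * (2 * n - K) * L
      - (δ * μ * (p + q) + q * (p - 1) * δ + p * (q - 1) * μ) * L := by rw [hMd]; ring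
  have hDL : D * L = δ * μ * L - (p - 1) * (q - 1) * L := by rw [hD]; ring
  have hDp : D * L * p = (δ * μ * L - (p - 1) * (q - 1) * L) * p := by rw [hDL]
  have hDq : D * L * q = (δ * μ * L - (p - 1) * (q - 1) * L) * q := by rw [hDL]
  linarith

/-- Two-sided bounds in the critical Laplacian case. -/
lemma exists_log_bounds (H : RadialHalf n 2 δ R u f v) (H' : RadialHalf n 2 μ R v g u)
    (hn : 2 < n) (hδ : 0 < δ) (hμ : 0 < μ) (hH : 0 < δ * μ - 1)
    (hcrit : n / (δ + 1) + n / (μ + 1) = n - 2) (hc : 0 < c)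
    (hE : ∀ r ∈ Set.Ioo 0 (R / 2), c ≤ radialEnergy n 2 2 δ μ (n - 2) u v f g r) :
    ∃ C, ∀ r ∈ Set.Ioo 0 (R / 2), |Real.log (u r) + n / (μ + 1) * Real.log r| ≤ C ∧
      |Real.log (v r) + n / (δ + 1) * Real.log r| ≤ C := by
  obtain ⟨C₁, h₁⟩ := H.exists_log_solution_le H' (by linarith) one_lt_two one_lt_two hδ hμ
  obtain ⟨C₂, h₂⟩ := H'.exists_log_solution_le H (by linarith) one_lt_two one_lt_two hμ hδ
  obtain ⟨C₃, h₃⟩ := H.exists_log_flux_le H' (by linarith) one_lt_two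
  obtain ⟨C₄, h₄⟩ := H'.exists_log_flux_le H (by linarith) one_lt_two
  set D := δ * μ - 1 with hD
  have hn' : n * D = 2 * (δ + 1) * (μ + 1) := by
    field_simp at hcrit
    rw [hD]
    linarith
  have hγ : n / (μ + 1) = (2 + 2 * δ) / D := by
    rw [div_eq_div_iff (by positivity) hH.ne', hn']
    ring
  have hξ : n / (δ + 1) = (2 + 2 * μ) / D := by
    rw [div_eq_div_iff (by positivity) hH.ne', hn']
    ring
  have up : ∀ r ∈ Set.Ioo 0 (R / 2), Real.log (u r) + n / (μ + 1) * Real.log r ≤ C₁ / D ∧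
      Real.log (v r) + n / (δ + 1) * Real.log r ≤ C₂ / D := by
    intro r hr
    have e₁ := h₁ r hr
    have e₂ := h₂ r hr
    rw [hγ, hξ]
    constructor
    · rw [le_div_iff₀ hH]
      have : (2 + 2 * δ) / D * Real.log r * D = (2 + 2 * δ) * Real.log r := by field_simp
      rw [add_mul, this, hD]
      linarith
    · rw [le_div_iff₀ hH]
      have : (2 + 2 * μ) / D * Real.log r * D = (2 + 2 * μ) * Real.log r := by field_simp
      rw [add_mul, this, hD]
      linarith
  refine ⟨max (max (C₁ / D) (C₂ / D))
    (max (C₁ / D) (C₂ / D) + C₃ + C₄ - Real.log c), fun r hr => ?_⟩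
  have hr' : r ∈ Set.Ioo 0 R := ⟨hr.1, by linarith [hr.1, hr.2]⟩
  have e₀ := H.log_energy_le H' (by linarith) hδ hμ hc hr' (hE r hr)
  have e₃ := h₃ r hr
  have e₄ := h₄ r hr
  obtain ⟨e₁, e₂⟩ := up r hr
  have m₁ := le_max_left (C₁ / D) (C₂ / D)
  have m₂ := le_max_right (C₁ / D) (C₂ / D)
  have hsum : n / (μ + 1) * Real.log r + n / (δ + 1) * Real.log r = (n - 2) * Real.log r := by
    rw [← hcrit]
    ring
  generalize max (C₁ / D) (C₂ / D) = m at *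
  have m₃ := le_max_left m (m + C₃ + C₄ - Real.log c)
  have m₄ := le_max_right m (m + C₃ + C₄ - Real.log c)
  constructor <;> rw [abs_le] <;> constructor <;> linarith

/-- Lower bound for the derivative of the monotone quantity `u^i v^j (α X + β Y)` in the critical
Laplacian case. -/
lemma critical_growth_identity {α β X Y Z W n : ℝ} (hα : 0 < α) (hβ : 0 < β)
    (hX : 0 < X) (hY : 0 < Y) (hZ : 0 ≤ Z) (hW : 0 ≤ W) (hn : 2 < n) (hs : n * (α + β) = n - 2) :
    (α + β) * (X * Y - α * (n - Z) * X - β * (n - W) * Y) ≤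
      α * X * (1 + (Z - (n - 1)) + X) + β * Y * (1 + (W - (n - 1)) + Y)
        - ((β - α) / (2 * β) * X - (β - α) / (2 * α) * Y) * (α * X + β * Y) := by
  have h1 : 0 ≤ (α + β) * (α * X - β * Y) ^ 2 / (2 * α * β) := by positivity
  have hs1 : α + β ≤ 1 := by nlinarith
  have h2 : 0 ≤ (1 - (α + β)) * (α * X * Z + β * Y * W) :=
    mul_nonneg (by linarith) (by positivity)
  have h3 : α * X * (1 + (Z - (n - 1)) + X) + β * Y * (1 + (W - (n - 1)) + Y)
        - ((β - α) / (2 * β) * X - (β - α) / (2 * α) * Y) * (α * X + β * Y)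
      - (α + β) * (X * Y - α * (n - Z) * X - β * (n - W) * Y)
      = (α + β) * (α * X - β * Y) ^ 2 / (2 * α * β)
        + (1 - (α + β)) * (α * X * Z + β * Y * W)
        + (n * (α + β) - (n - 2)) * (α * X + β * Y) := by
    field_simp
    ring
  rw [hs] at h3
  linarith

lemma false_of_critical (H : RadialHalf n 2 δ R u f v) (H' : RadialHalf n 2 μ R v g u)
    (hR : 0 < R) (hn : 2 < n) (hδ : 0 < δ) (hμ : 0 < μ) (hH : 0 < δ * μ - 1)
    (hcrit : n / (δ + 1) + n / (μ + 1) = n - 2) (hc : 0 < c)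
    (hE : ∀ r ∈ Set.Ioo 0 (R / 2), c ≤ radialEnergy n 2 2 δ μ (n - 2) u v f g r) : False := by
  obtain ⟨C, hC⟩ := H.exists_log_bounds H' hn hδ hμ hH hcrit hc hE
  set α := 1 / (δ + 1) with hα
  set β := 1 / (μ + 1) with hβ
  have hα0 : 0 < α := by positivity
  have hβ0 : 0 < β := by positivity
  have hs : n * (α + β) = n - 2 := by
    rw [← hcrit, hα, hβ]
    ring
  set i := (β - α) / (2 * β) with hi
  set j := -((β - α) / (2 * α)) with hj
  have hd : ∀ r ∈ Set.Ioo 0 (R / 2), HasDerivAt (fun r => u r ^ i * v r ^ j *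
      (α * slopeRatio u f r + β * slopeRatio v g r))
      (u r ^ i * v r ^ j * (α * slopeRatio u f r *
          (1 + (sourceRatio n 2 δ f v r - (n - 1)) + slopeRatio u f r)
        + β * slopeRatio v g r * (1 + (sourceRatio n 2 μ g u r - (n - 1)) + slopeRatio v g r)
        - ((β - α) / (2 * β) * slopeRatio u f r - (β - α) / (2 * α) * slopeRatio v g r)
          * (α * slopeRatio u f r + β * slopeRatio v g r)) / r) r := by
    intro r hr
    have hr' : r ∈ Set.Ioo 0 R := ⟨hr.1, by linarith [hr.1, hr.2]⟩
    have d₁ : HasDerivAt _ _ r := ((H.euler_solution hr').rpow (H.pos r hr') i).mul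
      ((H'.euler_solution hr').rpow (H'.pos r hr') j)
    have d₂ : HasDerivAt _ _ r := H.euler_slopeRatio one_lt_two hr'
    have d₃ : HasDerivAt _ _ r := H'.euler_slopeRatio one_lt_two hr'
    refine (d₁.fun_mul ((d₂.const_mul α).fun_add (d₃.const_mul β))).congr_deriv ?_
    rw [← hi]
    have : (β - α) / (2 * α) = -j := by rw [hj, neg_neg]
    rw [this]
    ring
  refine not_log_growth (c := Real.exp (-(|i - 1| * C + |j - 1| * C)) * ((α + β) * c))
    (by linarith : 0 < R / 2) (by positivity) ?_ hd ?_
  · intro r hr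
    have hr' : r ∈ Set.Ioo 0 R := ⟨hr.1, by linarith [hr.1, hr.2]⟩
    have h1 := H.slopeRatio_pos hr'
    have h2 := H'.slopeRatio_pos hr'
    have h3 := H.pos r hr'
    have h4 := H'.pos r hr'
    positivity
  · intro r hr
    have hr' : r ∈ Set.Ioo 0 R := ⟨hr.1, by linarith [hr.1, hr.2]⟩
    have hr0 := hr.1
    have hX := H.slopeRatio_pos hr'
    have hY := H'.slopeRatio_pos hr'
    have hu := H.pos r hr'
    have hv := H'.pos r hr'
    have key := critical_growth_identity hα0 hβ0 hX hY (H.sourceRatio_pos H' hr').le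
      (H'.sourceRatio_pos H hr').le hn hs
    have hΦ : c * r ^ (2 - n) / (u r * v r) ≤
        slopeRatio u f r * slopeRatio v g r
          - α * (n - sourceRatio n 2 δ f v r) * slopeRatio u f r
          - β * (n - sourceRatio n 2 μ g u r) * slopeRatio v g r := by
      have e1 : slopeRatio u f r * slopeRatio v g r
          - α * (n - sourceRatio n 2 δ f v r) * slopeRatio u f r
          - β * (n - sourceRatio n 2 μ g u r) * slopeRatio v g r
          = slopeRatio u f r * slopeRatio v g r * energyDensity n 2 2 δ μ u v f g r := by
        unfold energyDensity deficitRatio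
        rw [hα, hβ]
        field_simp
      have e2 : radialEnergy n 2 2 δ μ (n - 2) u v f g r * r ^ (2 - n) / (u r * v r)
          = slopeRatio u f r * slopeRatio v g r * energyDensity n 2 2 δ μ u v f g r := by
        have e3 : r ^ (n - 1) * r ^ (2 - n) = r := by
          rw [← Real.rpow_add hr0]
          norm_num
        have e4 : r ^ (-(n - 2)) = r ^ (2 - n) := by
          congr 1
          ring
        unfold radialEnergy radialFlux slopeRatio
        norm_num only [Real.rpow_one]
        rw [e4]
        calc _ = (r ^ (n - 1) * r ^ (2 - n)) * (r ^ (n - 1) * r ^ (2 - n)) * f r * g r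
              * energyDensity n 2 2 δ μ u v f g r / (u r * v r) := by ring
          _ = _ := by rw [e3]; field_simp
      rw [e1, ← e2]
      gcongr
      exact hE r hr
    obtain ⟨b₁, b₂⟩ := hC r hr
    have hlog : -(|i - 1| * C + |j - 1| * C) ≤
        Real.log (u r ^ i * v r ^ j * (r ^ (2 - n) / (u r * v r))) := by
      rw [Real.log_mul (by positivity) (by positivity), Real.log_mul (by positivity)
        (by positivity), Real.log_div (by positivity) (by positivity),
        Real.log_mul (by positivity) (by positivity), Real.log_rpow hu, Real.log_rpow hv,
        Real.log_rpow hr0]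
      have t₁ : -(|i - 1| * C) ≤ (i - 1) * (Real.log (u r) + n / (μ + 1) * Real.log r) := by
        have := neg_abs_le ((i - 1) * (Real.log (u r) + n / (μ + 1) * Real.log r))
        rw [abs_mul] at this
        linarith [mul_le_mul_of_nonneg_left b₁ (abs_nonneg (i - 1))]
      have t₂ : -(|j - 1| * C) ≤ (j - 1) * (Real.log (v r) + n / (δ + 1) * Real.log r) := by
        have := neg_abs_le ((j - 1) * (Real.log (v r) + n / (δ + 1) * Real.log r))
        rw [abs_mul] at this
        linarith [mul_le_mul_of_nonneg_left b₂ (abs_nonneg (j - 1))]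
      have t₃ : (i - 1) * (n / (μ + 1)) + (j - 1) * (n / (δ + 1)) = 2 - n := by
        have g₁ : n / (μ + 1) = n * β := by rw [hβ]; ring
        have g₂ : n / (δ + 1) = n * α := by rw [hα]; ring
        have g₃ : i * β = (β - α) / 2 := by rw [hi]; field_simp
        have g₄ : j * α = -((β - α) / 2) := by rw [hj]; field_simp
        rw [g₁, g₂]
        linear_combination n * g₃ + n * g₄ - hs
      have t₄ : (2 - n) * Real.log r = (i - 1) * (n / (μ + 1)) * Real.log r
          + (j - 1) * (n / (δ + 1)) * Real.log r := by
        rw [← t₃]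
        ring
      linarith
    rw [Real.le_log_iff_exp_le (by positivity)] at hlog
    have hω : 0 < u r ^ i * v r ^ j := by positivity
    calc _ ≤ u r ^ i * v r ^ j * (r ^ (2 - n) / (u r * v r)) * ((α + β) * c) := by gcongr
      _ = u r ^ i * v r ^ j * ((α + β) * (c * r ^ (2 - n) / (u r * v r))) := by ring
      _ ≤ _ := by
        refine (mul_le_mul_of_nonneg_left
          ((mul_le_mul_of_nonneg_left hΦ (by positivity)).trans key) hω.le).trans_eq ?_
        field_simp

end RadialHalf

/-- Positive solutions are decreasing: a positive flux near the origin would force `u → -∞`. -/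
lemma radialHalf_of_flux_eq {n p δ R : ℝ} {u v : ℝ → ℝ} (hp : 1 < p) (hpn : p ≤ n)
    (hu : ContDiffOn ℝ 2 u (Set.Ioo 0 R))
    (hupos : ∀ r ∈ Set.Ioo 0 R, 0 < u r) (hvpos : ∀ r ∈ Set.Ioo 0 R, 0 < v r)
    (hflux : ∀ r ∈ Set.Ioo 0 R,
      deriv (fun s => s ^ (n - 1) * |deriv u s| ^ (p - 2) * deriv u s) r
        = -(r ^ (n - 1) * v r ^ δ)) :
    RadialHalf n p δ R u (fun r => -deriv u r) v := by
  set w : ℝ → ℝ := fun s => s ^ (n - 1) * |deriv u s| ^ (p - 2) * deriv u s with hw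
  have hud : ∀ r ∈ Set.Ioo 0 R, HasDerivAt u (deriv u r) r := fun r hr =>
    ((hu.differentiableOn (by norm_num)).differentiableAt (Ioo_mem_nhds hr.1 hr.2)).hasDerivAt
  have hneg : ∀ r ∈ Set.Ioo 0 R, deriv w r < 0 := fun r hr => by
    rw [hflux r hr, neg_lt_zero]
    exact mul_pos (Real.rpow_pos_of_pos hr.1 _) (Real.rpow_pos_of_pos (hvpos r hr) _)
  have hwd : ∀ r ∈ Set.Ioo 0 R, DifferentiableAt ℝ w r := fun r hr =>
    differentiableAt_of_deriv_ne_zero (hneg r hr).ne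
  have hanti : StrictAntiOn w (Set.Ioo 0 R) :=
    strictAntiOn_of_deriv_neg (convex_Ioo _ _)
      (fun r hr => (hwd r hr).continuousAt.continuousWithinAt)
      (by rw [interior_Ioo]; exact hneg)
  have hpow : ∀ {x : ℝ}, 0 < x → x ^ (p - 2) * x = x ^ (p - 1) := fun {x} hx => by
    rw [← Real.rpow_add_one hx.ne']
    congr 1
    ring
  have hw_neg : ∀ r ∈ Set.Ioo 0 R, w r < 0 := by
    intro r₀ hr₀
    by_contra hcon
    push Not at hcon
    have hm : r₀ / 2 ∈ Set.Ioo 0 R := ⟨by linarith [hr₀.1], by linarith [hr₀.1, hr₀.2]⟩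
    have hc : 0 < w (r₀ / 2) := hcon.trans_lt (hanti hm hr₀ (by linarith [hr₀.1]))
    have hsub : ∀ {r}, r ∈ Set.Ioo 0 (r₀ / 2) → r ∈ Set.Ioo 0 R := fun hr =>
      ⟨hr.1, hr.2.trans hm.2⟩
    have hk : 0 < (r₀ / 2) ^ (p - n) * w (r₀ / 2) :=
      mul_pos (Real.rpow_pos_of_pos hm.1 _) hc
    refine not_log_growth hm.1 (Real.rpow_pos_of_pos hk (1 / (p - 1)))
      (fun r hr => hupos r (hsub hr)) (fun r hr => hud r (hsub hr)) (fun r hr => ?_)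
    have hwr : w (r₀ / 2) ≤ w r := (hanti (hsub hr) hm hr.2).le
    have hrn := Real.rpow_pos_of_pos hr.1 (n - 1)
    have hd : 0 < deriv u r := by
      by_contra hd
      push Not at hd
      have : w r ≤ 0 := mul_nonpos_of_nonneg_of_nonpos
        (mul_nonneg hrn.le (Real.rpow_nonneg (abs_nonneg _) _)) hd
      linarith
    have hwr' : w r = r ^ (n - 1) * deriv u r ^ (p - 1) := by
      simp only [hw]
      rw [abs_of_pos hd, mul_assoc, hpow hd]
    have hp0 : 0 < p - 1 := by linarith
    have hrd : 0 < r * deriv u r := mul_pos hr.1 hd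
    rw [← Real.rpow_le_rpow_iff (Real.rpow_nonneg hk.le _) hrd.le hp0, ← Real.rpow_mul hk.le,
      one_div_mul_cancel hp0.ne', Real.rpow_one, Real.mul_rpow hr.1.le hd.le]
    have h1 : (r₀ / 2) ^ (p - n) ≤ r ^ (p - n) :=
      Real.rpow_le_rpow_of_nonpos hr.1 hr.2.le (by linarith)
    have h2 : r ^ (p - n) * r ^ (n - 1) = r ^ (p - 1) := by
      rw [← Real.rpow_add hr.1]
      congr 1
      ring
    calc _ ≤ r ^ (p - n) * w r := by
          have := Real.rpow_pos_of_pos hr.1 (p - n)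
          gcongr
      _ = _ := by rw [hwr', ← mul_assoc, h2]
  have hdneg : ∀ r ∈ Set.Ioo 0 R, deriv u r < 0 := by
    intro r hr
    by_contra hd
    push Not at hd
    have : 0 ≤ w r := mul_nonneg (mul_nonneg (Real.rpow_nonneg hr.1.le _)
      (Real.rpow_nonneg (abs_nonneg _) _)) hd
    linarith [hw_neg r hr]
  refine ⟨hupos, fun r hr => neg_pos.2 (hdneg r hr), fun r hr => ?_, fun r hr => ?_⟩
  · simpa using hud r hr
  · have h1 := (hwd r hr).hasDerivAt.neg
    rw [hflux r hr, neg_neg] at h1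
    refine h1.congr_of_eventuallyEq ?_
    filter_upwards [Ioo_mem_nhds hr.1 hr.2] with s hs
    have hd := hdneg s hs
    simp only [radialFlux, hw, Pi.neg_apply]
    rw [abs_of_neg hd, ← hpow (neg_pos.2 hd)]
    ring

lemma tendsto_zero_at_boundary {u : ℝ → ℝ} {R : ℝ} (hR : 0 < R)
    (hu : ContDiffOn ℝ 1 u (Set.Ioc 0 R)) (h0 : u R = 0) :
    Filter.Tendsto u (nhdsWithin R (Set.Iio R)) (nhds 0) := by
  have h := (hu.continuousOn R ⟨hR, le_rfl⟩).mono Set.Ioo_subset_Ioc_self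
  rw [ContinuousWithinAt, h0, nhdsWithin_Ioo_eq_nhdsLT hR] at h
  exact h

/-- Exponent comparison: away from the critical Laplacian case the singular growth bounds are
incompatible with a positive energy. -/
lemma exponent_gap {n p q δ μ m : ℝ} (hp : 1 < p) (hp2 : p ≤ 2) (hq2 : q ≤ 2)
    (hδ : 0 < δ) (hμ : 0 < μ) (hn : 0 < n) (hm : 2 ≤ m)
    (hcond : n / (δ + 1) + n / (μ + 1) ≤ n - m)
    (hne : 2 < m ∨ n / (δ + 1) + n / (μ + 1) < n - m) :
    δ * μ * (p + q) + q * (p - 1) * δ + p * (q - 1) * μ <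
      (δ * μ - (p - 1) * (q - 1)) * (2 * n - (n - m)) := by
  have hk : 0 < (δ + 1) * (μ + 1) := by positivity
  have e : (n / (δ + 1) + n / (μ + 1)) * ((δ + 1) * (μ + 1)) = n * (δ + μ + 2) := by
    field_simp
    ring
  have h1 : m * ((δ + 1) * (μ + 1)) ≤ n * (δ * μ - 1) := by
    have := mul_le_mul_of_nonneg_right hcond hk.le
    rw [e] at this
    linarith
  have h2 : (p - 1) * (q - 1) ≤ 1 := by nlinarith
  have h3 : (δ * μ - 1) * (n + m) ≤ (δ * μ - (p - 1) * (q - 1)) * (n + m) :=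
    mul_le_mul_of_nonneg_right (by linarith) (by linarith)
  have hS : 0 < 2 * (δ * μ) + δ + μ := by positivity
  have h4 : δ * μ * (p + q) + q * (p - 1) * δ + p * (q - 1) * μ
      ≤ 2 * (2 * (δ * μ) + δ + μ) := by
    have a1 : q * (p - 1) ≤ 2 := by nlinarith
    have a2 : p * (q - 1) ≤ 2 := by nlinarith
    nlinarith [mul_pos hδ hμ]
  have e2 : 2 * n - (n - m) = n + m := by ring
  rw [e2]
  rcases hne with h | h
  · have := mul_lt_mul_of_pos_right h hS
    linarith
  · have h5 := mul_lt_mul_of_pos_right h hk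
    rw [e] at h5
    have := mul_le_mul_of_nonneg_right hm hS.le
    linarith

lemma conj_exponent_antitone {x y : ℝ} (hx : 1 < x) (hxy : x ≤ y) :
    y / (y - 1) ≤ x / (x - 1) := by
  rw [div_le_div_iff₀ (by linarith) (by linarith)]
  linarith

/-- Theorem 1.6(2): nonexistence of radial solutions (regular or not) to (S_R),
subquadratic case. -/
theorem nonexistence_subquadratic (N : ℕ) (hN : 2 < N) (p q δ μ : ℝ)
    (hδ : 0 < δ) (hμ : 0 < μ) (hH1 : 0 < δ * μ - (p - 1) * (q - 1))
    (hp1 : (N : ℝ) / (N - 1) < p) (hp2 : p ≤ 2)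
    (hq1 : (N : ℝ) / (N - 1) < q) (hq2 : q ≤ 2)
    (hineq : 1 / (δ + 1) + 1 / (μ + 1) ≤
      ((N : ℝ) * (min p q - 1) - min p q) / (N * (min p q - 1))) :
    ∀ R : ℝ, 0 < R → ¬ ∃ u v : ℝ → ℝ, IsRadialSolutionAux N p q δ μ R u v := by
  rintro R hR ⟨u, v, hu1, hv1, hu2, hv2, hup, hvp, huR, hvR, hfu, hfv⟩
  have hn : (2:ℝ) < N := by exact_mod_cast hN
  generalize (N:ℝ) = n at *
  have hn1 : 1 < n / (n - 1) := by
    rw [one_lt_div (by linarith)]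
    linarith
  have hp := hn1.trans hp1
  have hq := hn1.trans hq1
  have H := radialHalf_of_flux_eq hp (by linarith) hu2 hup hvp hfu
  have H' := radialHalf_of_flux_eq hq (by linarith) hv2 hvp hup hfv
  have hm1 : 1 < min p q := lt_min hp hq
  have hmp := min_le_left p q
  have hmq := min_le_right p q
  have hm2 : min p q < 2 ∨ p = 2 ∧ q = 2 := by
    rcases hp2.lt_or_eq with h | h
    · exact Or.inl (hmp.trans_lt h)
    · rcases hq2.lt_or_eq with h' | h'
      · exact Or.inl (hmq.trans_lt h')
      · exact Or.inr ⟨h, h'⟩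
  have hmin : p = 2 ∧ q = 2 → min p q = 2 := by
    rintro ⟨rfl, rfl⟩
    exact min_self _
  generalize min p q = m at *
  have hm0 : 0 < m - 1 := by linarith
  have hcond : n / (δ + 1) + n / (μ + 1) ≤ n - m / (m - 1) := by
    have h := mul_le_mul_of_nonneg_left hineq (by linarith : 0 ≤ n)
    have e : n * ((n * (m - 1) - m) / (n * (m - 1))) = n - m / (m - 1) := by
      field_simp
    rw [e] at h
    calc _ = n * (1 / (δ + 1) + 1 / (μ + 1)) := by ring
      _ ≤ _ := h
  obtain ⟨c, hc, hE⟩ := H.exists_radialEnergy_lower_bound (K := n - m / (m - 1)) H' hR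
    (by linarith) hp hq hp2 hq2 hδ hμ
    (by linarith [conj_exponent_antitone hm1 hmp]) (by linarith [conj_exponent_antitone hm1 hmq])
    hcond (tendsto_zero_at_boundary hR hu1 huR) (tendsto_zero_at_boundary hR hv1 hvR)
  have hm2' : m ≤ 2 := hmp.trans hp2
  have hconj : 2 ≤ m / (m - 1) := by
    rw [le_div_iff₀ hm0]
    linarith
  have finish : 2 < m / (m - 1) ∨ n / (δ + 1) + n / (μ + 1) < n - m / (m - 1) → False :=
    fun h => H.false_of_supercritical H' hR (by linarith) hp hq hδ hμ hH1 hc hE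
      (exponent_gap hp hp2 hq2 hδ hμ (by linarith) hconj hcond h)
  rcases hm2 with h | h
  · refine finish (Or.inl ?_)
    rw [lt_div_iff₀ hm0]
    linarith
  · rcases hcond.lt_or_eq with h' | h'
    · exact finish (Or.inr h')
    · have hm := hmin h
      obtain ⟨rfl, rfl⟩ := h
      have e : m / (m - 1) = 2 := by rw [hm]; norm_num
      rw [e] at hE h'
      exact H.false_of_critical H' hR hn hδ hμ (by linarith) h' hc hE
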